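/- Let q and w be Hilbert functions of closed projective subschemes (i.e. q, w and their first derivatives are admissible functions), and let m > 1 be an integer such that w(m-1) = q(m-1) and w(m-2) <= q(m-2). Define h(j) := w(j) for all j < m and h(j) := q(j) for all j >= m. Then h is the Hilbert function of a closed projective subscheme, and m_h <= max{m, m_q}. -/

import Mathlib

open scoped Classical

noncomputable section

/-! ## Binomial expansions and the Macaulay operations `(a_t)^+_+` and `(a_t)^-_-` -/

/-- The largest `k` such that `C(k,t) ≤ a` (top coefficient of the greedy binomial
expansion of `a` in base `t`). -/
def expTop (a t : ℕ) : ℕ := Nat.findGreatest (fun k => Nat.choose k t ≤ a) (a + t + 1)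

/-- `(a_t)^+_+` : if `a = C(k(t),t) + ... + C(k(j),j)` is the binomial expansion of `a`
in base `t`, then `plusPlus a t = C(k(t)+1,t+1) + ... + C(k(j)+1,j+1)`; it sends `0` to `0`. -/
def plusPlus : ℕ → ℕ → ℕ
  | _, 0 => 0
  | a, t + 1 =>
    if a = 0 then 0
    else Nat.choose (expTop a (t + 1) + 1) (t + 2) +
      plusPlus (a - Nat.choose (expTop a (t + 1)) (t + 1)) t

/-- `(a_t)^-_-` : if `a = C(k(t),t) + ... + C(k(j),j)` is the binomial expansion of `a`
in base `t`, then `minusMinus a t = C(k(t)-1,t-1) + ... + C(k(j)-1,j-1)`; it sends `0` to `0`. -/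
def minusMinus : ℕ → ℕ → ℕ
  | _, 0 => 0
  | a, t + 1 =>
    if a = 0 then 0
    else Nat.choose (expTop a (t + 1) - 1) t +
      minusMinus (a - Nat.choose (expTop a (t + 1)) (t + 1)) t

/-! ## Numerical functions -/

/-- A numerical function (modelled with values in `ℤ`) is *admissible* (an O-sequence) if it is
nonnegative, `H 0 = 1` and `H (t+1) ≤ (H(t)_t)^+_+` for every `t ≥ 1`. -/
def OSeq (H : ℕ → ℤ) : Prop :=
  (∀ t, 0 ≤ H t) ∧ H 0 = 1 ∧ ∀ t, 1 ≤ t → H (t + 1) ≤ (plusPlus (H t).toNat t : ℤ)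

/-- First derivative of a numerical function: `Δf(0) = 1`, `Δf(t) = f(t) - f(t-1)`. -/
def nderiv (f : ℕ → ℤ) : ℕ → ℤ
  | 0 => 1
  | t + 1 => f (t + 1) - f t

/-- Integral of a numerical function: `Σg(0) = 1`, `Σg(t) = Σg(t-1) + g(t)`. -/
def ninteg (g : ℕ → ℤ) : ℕ → ℤ
  | 0 => 1
  | t + 1 => ninteg g t + g (t + 1)

/-! ## Admissible Hilbert polynomials in Gotzmann form -/

/-- The integer-valued binomial coefficient `C(a,k)` for `a : ℤ`, agreeing with the
polynomial binomial coefficient `a(a-1)⋯(a-k+1)/k!`. -/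
def zchoose (a : ℤ) (k : ℕ) : ℤ :=
  if 0 ≤ a then (a.toNat.choose k : ℤ)
  else (-1) ^ k * (((k : ℤ) - 1 - a).toNat.choose k : ℤ)

/-- An admissible Hilbert polynomial, recorded through its Gotzmann form
`p(z) = C(z+k₁,k₁) + C(z+k₂-1,k₂) + ... + C(z+k_r-(r-1),k_r)` with `k₁ ≥ k₂ ≥ ... ≥ k_r ≥ 0`. -/
structure GotzmannPoly where
  ks : List ℕ
  sorted : ks.Pairwise (· ≥ ·)

namespace GotzmannPoly

/-- The Gotzmann number `r` of `p`. -/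
def r (p : GotzmannPoly) : ℕ := p.ks.length

/-- The degree of `p`, namely `k₁`. -/
def degree (p : GotzmannPoly) : ℕ := p.ks.headD 0

/-- Evaluation of `p` at an integer. -/
def eval (p : GotzmannPoly) (z : ℤ) : ℤ :=
  ∑ i ∈ Finset.range p.r, zchoose (z + (p.ks.getD i 0 : ℤ) - i) (p.ks.getD i 0)

/-- The first difference `Δp(z) = p(z) - p(z-1)`, in Gotzmann form. -/
def delta (p : GotzmannPoly) : GotzmannPoly where
  ks := (p.ks.filter fun k => 1 ≤ k).map fun k => k - 1
  sorted := by
    refine List.Pairwise.map _ (fun {a b} h => Nat.sub_le_sub_right h 1) ?_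
    exact p.sorted.filter _

/-- Iterated first difference `Δ^i p`. -/
def deltaIter (p : GotzmannPoly) (i : ℕ) : GotzmannPoly := delta^[i] p

/-- The polynomial `p(z) + c`, in Gotzmann form. -/
def addConst (p : GotzmannPoly) (c : ℕ) : GotzmannPoly where
  ks := p.ks ++ List.replicate c 0
  sorted := by
    rw [List.pairwise_append]
    refine ⟨p.sorted, ?_, ?_⟩
    · exact List.pairwise_replicate.2 (Or.inr le_rfl)
    · intro a _ b hb
      rw [List.eq_of_mem_replicate hb]
      exact Nat.zero_le a

end GotzmannPoly

/-- The set `Π_p = {1 ≤ t ≤ r : (p(t+h)_{t+h})^+_+ ≥ p(t+h+1) ≥ 1 for all h ≥ 0}`. -/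
def PiSet (p : GotzmannPoly) : Set ℕ :=
  {t | 1 ≤ t ∧ t ≤ p.r ∧ ∀ h : ℕ,
      p.eval ((t : ℤ) + (h : ℤ) + 1) ≤ (plusPlus (p.eval ((t : ℤ) + (h : ℤ))).toNat (t + h) : ℤ) ∧
      1 ≤ p.eval ((t : ℤ) + (h : ℤ) + 1)}

/-- `ρ_p`: `0` if `min Π_p = 1` and `p(0) = 1`, and `min Π_p` otherwise. -/
def rhoP (p : GotzmannPoly) : ℕ :=
  if sInf (PiSet p) = 1 ∧ p.eval 0 = 1 then 0 else sInf (PiSet p)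

/-- The minimal function `f^ρ_p` : `f(t) = p(t)` for `t ≥ ρ` and
`f(t) = ((f(t+1))_{t+1})^-_-` for `t < ρ`. -/
def fmin (p : GotzmannPoly) (ρ : ℕ) (t : ℕ) : ℤ :=
  if h : ρ ≤ t then p.eval (t : ℤ)
  else (minusMinus (fmin p ρ (t + 1)).toNat (t + 1) : ℤ)
termination_by ρ - t
decreasing_by omega

/-- The function `g^ρ_p` : `g(t) = p(t)` for `t ≥ ρ`, `g(ρ-1) = p(ρ-1) + 1` and
`g(t) = ((g(t+1))_{t+1})^-_-` for `t < ρ-1`. -/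
def gmin (p : GotzmannPoly) (ρ : ℕ) (t : ℕ) : ℤ :=
  if h : ρ ≤ t then p.eval (t : ℤ)
  else if t = ρ - 1 then p.eval (t : ℤ) + 1
  else (minusMinus (gmin p ρ (t + 1)).toNat (t + 1) : ℤ)
termination_by ρ - t
decreasing_by omega

/-- `H` has regularity `ρ` (with respect to the Hilbert polynomial `p`): `ρ` is the least
integer such that `H(t) = p(t)` for all `t ≥ ρ`. -/
def IsRegOf (p : GotzmannPoly) (H : ℕ → ℤ) (ρ : ℕ) : Prop :=
  (∀ t : ℕ, ρ ≤ t → H t = p.eval (t : ℤ)) ∧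
  ∀ ρ' : ℕ, (∀ t : ℕ, ρ' ≤ t → H t = p.eval (t : ℤ)) → ρ ≤ ρ'

/-- `H` has Hilbert polynomial `p`, i.e. eventually agrees with `p`. -/
def HasHP (p : GotzmannPoly) (H : ℕ → ℤ) : Prop :=
  ∃ N : ℕ, ∀ t : ℕ, N ≤ t → H t = p.eval (t : ℤ)

/-- `F(p,ρ)`: the set of Hilbert functions of closed projective subschemes (i.e. numerical
functions which are admissible together with their first derivative) with Hilbert
polynomial `p` and regularity `ρ`. -/
def Fset (p : GotzmannPoly) (ρ : ℕ) : Set (ℕ → ℤ) :=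
  {H | OSeq H ∧ OSeq (nderiv H) ∧ IsRegOf p H ρ}

/-- `ρ̄_p`: the minimal `ρ` such that `F(p,ρ)` is non-empty. -/
def rhobar (p : GotzmannPoly) : ℕ := sInf {ρ | (Fset p ρ).Nonempty}

/-! ## Monomial ideals in `K[x₀,…,xₙ]` (combinatorial model) -/

/-- Monomials of `K[x₀,…,xₙ]`, as exponent vectors. -/
abbrev Mon (n : ℕ) := Fin (n + 1) → ℕ

/-- Degree of a monomial. -/
def mdeg {n : ℕ} (m : Mon n) : ℕ := ∑ i, m i

/-- `T_t`, the set of terms of degree `t`. -/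
def Tset (n t : ℕ) : Set (Mon n) := {m | mdeg m = t}

/-- A set of monomials closed under multiplication by arbitrary monomials (a monomial ideal). -/
def MonIdeal {n : ℕ} (J : Set (Mon n)) : Prop :=
  ∀ m ∈ J, ∀ m' : Mon n, m + m' ∈ J

/-- The elementary Borel move sending `x^m` to `x_i · x^m / x_j`. -/
def borelStep {n : ℕ} (m : Mon n) (j i : Fin (n + 1)) : Mon n :=
  fun l => if l = j then m l - 1 else if l = i then m l + 1 else m l

/-- One elementary Borel move `x_j ↦ x_i` with `j < i`. -/
def borelMove {n : ℕ} (a b : Mon n) : Prop :=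
  ∃ j i : Fin (n + 1), j < i ∧ 1 ≤ a j ∧ b = borelStep a j i

/-- The Borel (partial) order `≤_B` on monomials. -/
def borelLE {n : ℕ} : Mon n → Mon n → Prop := Relation.ReflTransGen borelMove

/-- A strongly stable (Borel) monomial ideal. -/
def StronglyStable {n : ℕ} (J : Set (Mon n)) : Prop :=
  MonIdeal J ∧ ∀ m ∈ J, ∀ j i : Fin (n + 1), j < i → 1 ≤ m j → borelStep m j i ∈ J

/-- A Borel set in `T_t`: a set of degree-`t` monomials closed upwards under `≤_B`. -/
def IsBorelSet {n : ℕ} (t : ℕ) (B : Set (Mon n)) : Prop :=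
  B ⊆ Tset n t ∧ ∀ a ∈ B, ∀ b : Mon n, borelLE a b → b ∈ B

/-- Saturation of a monomial ideal:
`J^sat = {m : for every i there is k with x_i^k · m ∈ J}`. -/
def monSat {n : ℕ} (J : Set (Mon n)) : Set (Mon n) :=
  {m | ∀ i : Fin (n + 1), ∃ k : ℕ, (fun l => if l = i then m l + k else m l) ∈ J}

/-- The monomial ideal generated by a set of monomials. -/
def genIdeal {n : ℕ} (B : Set (Mon n)) : Set (Mon n) :=
  {m | ∃ b ∈ B, ∃ c : Mon n, m = b + c}

/-- The Hilbert function of `S/J` for a monomial ideal `J`: the number of degree-`t`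
monomials outside `J`. -/
def hilb {n : ℕ} (J : Set (Mon n)) (t : ℕ) : ℕ :=
  Set.ncard {m : Mon n | mdeg m = t ∧ m ∉ J}

/-- `m / x_i` as an exponent vector. -/
def shrinkAt {n : ℕ} (m : Mon n) (i : Fin (n + 1)) : Mon n :=
  fun l => if l = i then m l - 1 else m l

/-- `m` is a minimal (monomial) generator of the monomial ideal `J`. -/
def IsMinGen {n : ℕ} (J : Set (Mon n)) (m : Mon n) : Prop :=
  m ∈ J ∧ ∀ i : Fin (n + 1), 1 ≤ m i → shrinkAt m i ∉ J

/-- The Castelnuovo–Mumford regularity of a strongly stable ideal: the maximal degree of a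
minimal monomial generator. -/
def monReg {n : ℕ} (J : Set (Mon n)) : ℕ :=
  sSup {d | ∃ m : Mon n, IsMinGen J m ∧ mdeg m = d}

/-- `m_u`: the minimal Castelnuovo–Mumford regularity of a closed projective subscheme with
Hilbert function `u`, i.e. the minimum of `reg J` over all `n` and all saturated strongly
stable ideals `J ⊆ K[x₀,…,xₙ]` with `H_{S/J} = u`. -/
def mReg (u : ℕ → ℤ) : ℕ :=
  sInf {r | ∃ (n : ℕ) (J : Set (Mon n)), StronglyStable J ∧ monSat J = J ∧
      (∀ t : ℕ, (hilb J t : ℤ) = u t) ∧ monReg J = r}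

/-- `M(p,ρ) = {m_u : u ∈ F(p,ρ)}`. -/
def Mset (p : GotzmannPoly) (ρ : ℕ) : Set ℕ := {r | ∃ u ∈ Fset p ρ, mReg u = r}

/-- `m^ρ_p = min M(p,ρ)`. -/
def mRho (p : GotzmannPoly) (ρ : ℕ) : ℕ := sInf (Mset p ρ)

/-- `m_p`: the minimal Castelnuovo–Mumford regularity of schemes with Hilbert polynomial `p`. -/
def mP (p : GotzmannPoly) : ℕ := sInf {r | ∃ ρ : ℕ, ∃ u ∈ Fset p ρ, mReg u = r}

/-! ## Lex segments and growth-height-lexicographic Borel sets -/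

/-- `a` is smaller than `b` in the deglex order (for monomials of the same degree):
`a k < b k` where `k` is the largest index where they differ. -/
def deglexLT {n : ℕ} (a b : Mon n) : Prop :=
  ∃ k : Fin (n + 1), a k < b k ∧ ∀ l : Fin (n + 1), k < l → a l = b l

/-- A lex-segment of `T_t`: a set of degree-`t` monomials consisting of the highest terms
with respect to deglex. -/
def IsLexSeg {n : ℕ} (t : ℕ) (L : Set (Mon n)) : Prop :=
  L ⊆ Tset n t ∧ ∀ a ∈ L, ∀ b ∈ Tset n t, deglexLT a b → b ∈ L

/-- A lex-segment in `A ⊆ T_t`: the intersection of a lex-segment of `T_t` with `A`. -/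
def LexSegIn {n : ℕ} (t : ℕ) (A S : Set (Mon n)) : Prop :=
  ∃ L : Set (Mon n), IsLexSeg t L ∧ S = L ∩ A

/-- The growth class `B^{(i)} = {m ∈ B : min(m) = i}`. -/
def growthClass {n : ℕ} (B : Set (Mon n)) (i : Fin (n + 1)) : Set (Mon n) :=
  {m | m ∈ B ∧ 1 ≤ m i ∧ ∀ j : Fin (n + 1), j < i → m j = 0}

/-- The height class `B(i) = {m ∈ B : the exponent of x₀ in m is i}`. -/
def heightClass {n : ℕ} (B : Set (Mon n)) (i : ℕ) : Set (Mon n) :=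
  {m | m ∈ B ∧ m 0 = i}

/-- A Borel set `B ⊆ T_t` is growth-lexicographic if all its growth classes are lex-segments
in the corresponding growth classes of `T_t`. -/
def GrowthLex {n : ℕ} (t : ℕ) (B : Set (Mon n)) : Prop :=
  ∀ i : Fin (n + 1), LexSegIn t (growthClass (Tset n t) i) (growthClass B i)

/-- A Borel set `B ⊆ T_t` is growth-height-lexicographic if `B(0)` is growth-lexicographic
and `B(i)` is a lex-segment in `T_t(i)` for every `0 < i ≤ t`. -/
def GHLex {n : ℕ} (t : ℕ) (B : Set (Mon n)) : Prop :=
  GrowthLex t (heightClass B 0) ∧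
  ∀ i : ℕ, 0 < i → i ≤ t → LexSegIn t (heightClass (Tset n t) i) (heightClass B i)

end


/-! ## Monomials as descending lists -/

/-- Descending lists of natural numbers: the list of the indices of the variables of a monomial,
with multiplicity, from the largest to the smallest. -/
def Desc (u : List ℕ) : Prop := u.Pairwise (· ≥ ·)

/-- The position of a descending list among the descending lists of the same length, ordered
lexicographically. -/
def rank : List ℕ → ℕ
  | [] => 0
  | x :: l => Nat.choose (x + l.length) (l.length + 1) + rank l

theorem desc_cons {x : ℕ} {l : List ℕ} : Desc (x :: l) ↔ (∀ y ∈ l, y ≤ x) ∧ Desc l := by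
  simp [Desc]

theorem desc_concat {l : List ℕ} {x : ℕ} : Desc (l ++ [x]) ↔ Desc l ∧ ∀ y ∈ l, x ≤ y := by
  simp [Desc, List.pairwise_append]

theorem desc_map_add {l : List ℕ} (i : ℕ) : Desc (l.map (· + i)) ↔ Desc l := by
  simp [Desc, List.pairwise_map]

theorem desc_map_pred {l : List ℕ} (h : Desc l) : Desc (l.map (· - 1)) := by
  rw [Desc, List.pairwise_map]
  exact List.Pairwise.imp (fun {a b} hab => by simp only [ge_iff_le] at *; omega) h

theorem rank_lt_choose {x : ℕ} {l : List ℕ} (hl : Desc l) (hx : ∀ y ∈ l, y ≤ x) :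
    rank l < Nat.choose (x + l.length) l.length := by
  induction l generalizing x with
  | nil => simp [rank]
  | cons y l ih =>
    rw [desc_cons] at hl
    have h1 := ih hl.2 hl.1
    have h2 : Nat.choose (y + l.length + 1) (l.length + 1) ≤
        Nat.choose (x + (l.length + 1)) (l.length + 1) :=
      Nat.choose_le_choose _ (by have := hx y (by simp); omega)
    rw [Nat.choose_succ_succ'] at h2
    simp only [rank, List.length_cons]
    omega

theorem rank_cons_lt {x y : ℕ} {l k : List ℕ} (hl : Desc (x :: l)) (hlen : l.length = k.length)
    (h : x < y) : rank (x :: l) < rank (y :: k) := by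
  rw [desc_cons] at hl
  have h1 := rank_lt_choose hl.2 hl.1
  have h2 : Nat.choose (x + l.length + 1) (l.length + 1) ≤
      Nat.choose (y + l.length) (l.length + 1) :=
    Nat.choose_le_choose _ (by omega)
  rw [Nat.choose_succ_succ'] at h2
  simp only [rank, ← hlen]
  omega

theorem rank_cons_lt_iff {x y : ℕ} {l k : List ℕ} (hl : Desc (x :: l)) (hk : Desc (y :: k))
    (hlen : l.length = k.length) :
    rank (x :: l) < rank (y :: k) ↔ x < y ∨ x = y ∧ rank l < rank k := by
  rcases lt_trichotomy x y with h | h | h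
  · simp [h, rank_cons_lt hl hlen h]
  · subst h
    simp [rank, hlen]
  · have := rank_cons_lt hk hlen.symm h
    constructor
    · omega
    · omega

theorem rank_injective {u v : List ℕ} (hu : Desc u) (hv : Desc v) (hlen : u.length = v.length)
    (h : rank u = rank v) : u = v := by
  induction u generalizing v with
  | nil => exact (List.length_eq_zero_iff.1 hlen.symm).symm
  | cons x l ih =>
    cases v with
    | nil => simp at hlen
    | cons y k =>
      have hlen' : l.length = k.length := by simpa using hlen
      have hxy : x = y := by
        rcases lt_trichotomy x y with h' | h' | h'
        · have := rank_cons_lt hu hlen' h'; omega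
        · exact h'
        · have := rank_cons_lt hv hlen'.symm h'; omega
      subst hxy
      rw [ih (desc_cons.1 hu).2 (desc_cons.1 hv).2 hlen']
      simpa [rank, hlen'] using h

theorem rank_concat_lt {u v : List ℕ} {i j : ℕ} (hu : Desc (u ++ [i])) (hv : Desc (v ++ [j]))
    (hlen : u.length = v.length) (h : rank u < rank v) : rank (u ++ [i]) < rank (v ++ [j]) := by
  induction u generalizing v with
  | nil =>
    have := List.length_eq_zero_iff.1 hlen.symm
    subst this
    simp at h
  | cons x l ih =>
    cases v with
    | nil => simp at hlen
    | cons y k =>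
      have hlen' : l.length = k.length := by simpa using hlen
      rw [rank_cons_lt_iff (desc_concat.1 hu).1 (desc_concat.1 hv).1 hlen'] at h
      simp only [List.cons_append] at hu hv ⊢
      rw [rank_cons_lt_iff hu hv (by simp [hlen'])]
      exact h.imp_right fun h => ⟨h.1, ih (desc_cons.1 hu).2 (desc_cons.1 hv).2 hlen' h.2⟩

theorem rank_map_succ_lt {u v : List ℕ} (hu : Desc u) (hv : Desc v)
    (hlen : u.length = v.length) (h : rank u < rank v) :
    rank (u.map (· + 1)) < rank (v.map (· + 1)) := by
  induction u generalizing v with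
  | nil =>
    have := List.length_eq_zero_iff.1 hlen.symm
    subst this
    simp at h
  | cons x l ih =>
    cases v with
    | nil => simp at hlen
    | cons y k =>
      have hlen' : l.length = k.length := by simpa using hlen
      rw [rank_cons_lt_iff hu hv hlen'] at h
      have hu' := (desc_map_add 1).2 hu
      have hv' := (desc_map_add 1).2 hv
      simp only [List.map_cons] at hu' hv' ⊢
      rw [rank_cons_lt_iff hu' hv' (by simp [hlen'])]
      exact h.imp (by omega)
        fun h => ⟨by omega, ih (desc_cons.1 hu).2 (desc_cons.1 hv).2 hlen' h.2⟩

theorem rank_mono {u v : List ℕ} (h : List.Forall₂ (· ≤ ·) u v) : rank u ≤ rank v := by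
  induction h with
  | nil => simp
  | cons hab hlk ih =>
    simp only [rank, hlk.length_eq]
    exact add_le_add (Nat.choose_le_choose _ (by omega)) ih

theorem rank_concat_succ (c : List ℕ) (y : ℕ) : rank (c ++ [y + 1]) = rank (c ++ [y]) + 1 := by
  induction c with
  | nil => simp [rank]
  | cons x c ih => simp [rank, ih]; omega

theorem rank_map_succ_concat (c : List ℕ) (y : ℕ) :
    rank ((c ++ [y]).map (· + 1)) = rank (c.map (· + 1)) + rank (c ++ [y]) + 1 := by
  induction c with
  | nil => simp [rank]
  | cons x c ih =>
    simp only [List.map_append, List.map_cons, List.map_nil, List.cons_append, rank,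
      List.length_append, List.length_map, List.length_cons, List.length_nil] at ih ⊢
    have h : Nat.choose (x + 1 + (c.length + (0 + 1))) (c.length + (0 + 1) + 1) =
        Nat.choose (x + 1 + c.length) (c.length + 1) +
          Nat.choose (x + (c.length + (0 + 1))) (c.length + (0 + 1) + 1) := by
      rw [show x + 1 + (c.length + (0 + 1)) = (x + 1 + c.length) + 1 by ring,
        show c.length + (0 + 1) = c.length + 1 by ring, Nat.choose_succ_succ',
        show x + 1 + c.length = x + (c.length + 1) by ring]
    omega

theorem rank_concat_zero (c : List ℕ) :
    rank (c ++ [0]) = rank c + rank ((c ++ [0]).map (· - 1)) := by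
  induction c with
  | nil => simp [rank]
  | cons x c ih =>
    simp only [List.map_append, List.map_cons, List.map_nil, List.cons_append, rank,
      List.length_append, List.length_map, List.length_cons, List.length_nil] at ih ⊢
    have h : Nat.choose (x + (c.length + (0 + 1))) (c.length + (0 + 1) + 1) =
        Nat.choose (x + c.length) (c.length + 1) +
          Nat.choose (x - 1 + (c.length + (0 + 1))) (c.length + (0 + 1) + 1) := by
      cases x with
      | zero => simp
      | succ x =>
        rw [show x + 1 + (c.length + (0 + 1)) = (x + 1 + c.length) + 1 by ring,
          show c.length + (0 + 1) = c.length + 1 by ring, Nat.choose_succ_succ',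
          show x + 1 - 1 + (c.length + 1) = x + 1 + c.length by omega]
    omega

/-! ## Binomial expansions -/

theorem lt_choose_add (a s : ℕ) : a < Nat.choose (a + s + 1) (s + 1) := by
  induction s with
  | zero => simp
  | succ s ih =>
    rw [show a + (s + 1) + 1 = (a + s + 1) + 1 by ring, Nat.choose_succ_succ']
    omega

theorem choose_expTop_le (a t : ℕ) : Nat.choose (expTop a (t + 1)) (t + 1) ≤ a := by
  unfold expTop
  exact Nat.findGreatest_spec (P := fun k => Nat.choose k (t + 1) ≤ a) (m := t) (by omega)
    (by simp)

theorem le_expTop (a t : ℕ) : t ≤ expTop a (t + 1) := by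
  unfold expTop
  exact Nat.le_findGreatest (by omega) (by simp)

theorem lt_choose_expTop (a t : ℕ) : a < Nat.choose (expTop a (t + 1) + 1) (t + 1) := by
  by_contra! h
  have hb : expTop a (t + 1) + 1 ≤ a + (t + 1) + 1 := by
    by_contra! hlt
    have h2 := (lt_choose_add a t).trans_le
      (Nat.choose_le_choose (t + 1) (show a + t + 1 ≤ expTop a (t + 1) + 1 by omega))
    omega
  have : expTop a (t + 1) + 1 ≤ expTop a (t + 1) := by
    conv_rhs => unfold expTop
    exact Nat.le_findGreatest hb h
  omega

theorem plusPlus_zero (t : ℕ) : plusPlus 0 t = 0 := by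
  cases t <;> simp [plusPlus]

theorem plusPlus_succ (a t : ℕ) : plusPlus a (t + 1) =
    Nat.choose (expTop a (t + 1) + 1) (t + 2) +
      plusPlus (a - Nat.choose (expTop a (t + 1)) (t + 1)) t := by
  by_cases ha : a = 0
  · subst ha
    have h1 := lt_choose_expTop 0 t
    have h2 := le_expTop 0 t
    have h3 := choose_expTop_le 0 t
    have h4 : expTop 0 (t + 1) < t + 1 := by
      by_contra! h
      have := Nat.choose_pos h
      omega
    simp only [plusPlus_zero, Nat.zero_sub, add_zero]
    rw [Nat.choose_eq_zero_of_lt]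
    omega
  · rw [plusPlus]
    simp [ha]

theorem exists_rank_eq (t a : ℕ) (h : t = 0 → a = 0) :
    ∃ u, Desc u ∧ u.length = t ∧ rank u = a ∧ rank (u ++ [0]) = plusPlus a t := by
  induction t generalizing a with
  | zero => exact ⟨[], by simp [Desc], rfl, by simp [rank, h rfl], by simp [rank, plusPlus]⟩
  | succ t ih =>
    have h1 := lt_choose_expTop a t
    have h2 := le_expTop a t
    have h3 := choose_expTop_le a t
    have h4 := plusPlus_succ a t
    generalize expTop a (t + 1) = k at *
    obtain ⟨x, rfl⟩ := Nat.exists_eq_add_of_le' h2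
    rw [Nat.choose_succ_succ'] at h1
    obtain ⟨u, hu, hlen, hr, hp⟩ := ih (a - Nat.choose (x + t) (t + 1)) (by
      rintro rfl
      simp only [Nat.choose_zero_right] at h1
      simp at h1 h3 ⊢
      omega)
    refine ⟨x :: u, desc_cons.2 ⟨?_, hu⟩, by simp [hlen], ?_, ?_⟩
    · intro y hy
      cases u with
      | nil => simp at hy
      | cons z u =>
        have hyz : y ≤ z := by
          rcases List.mem_cons.1 hy with rfl | hy
          · exact le_rfl
          · exact (desc_cons.1 hu).1 y hy
        refine hyz.trans ?_
        by_contra! hlt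
        simp only [rank] at hr
        simp only [List.length_cons] at hlen
        have := Nat.choose_le_choose (u.length + 1)
          (show x + t ≤ z + u.length by omega)
        subst hlen
        omega
    · simp only [rank, hlen, hr]
      omega
    · simp only [List.cons_append, rank, hp, List.length_append, hlen, h4, List.length_cons,
        List.length_nil]
      congr 2

theorem rank_le_of_concat_le {u v : List ℕ} {i j : ℕ} (hu : Desc (u ++ [i]))
    (hv : Desc (v ++ [j])) (hlen : u.length = v.length) (h : rank (u ++ [i]) ≤ rank (v ++ [j])) :
    rank u ≤ rank v := by
  by_contra! hlt
  have := rank_concat_lt hv hu hlen.symm hlt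
  omega

theorem desc_concat_zero {u : List ℕ} : Desc (u ++ [0]) ↔ Desc u := by
  simp [desc_concat]

theorem rank_concat_zero_le {u v : List ℕ} (hu : Desc u) (hv : Desc v)
    (hlen : u.length = v.length) (h : rank u ≤ rank v) : rank (u ++ [0]) ≤ rank (v ++ [0]) := by
  rcases h.lt_or_eq with h | h
  · exact (rank_concat_lt (desc_concat_zero.2 hu) (desc_concat_zero.2 hv) hlen h).le
  · rw [rank_injective hu hv hlen h]

theorem plusPlus_mono {a b : ℕ} (t : ℕ) (h : a ≤ b) : plusPlus a t ≤ plusPlus b t := by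
  rcases Nat.eq_zero_or_pos t with rfl | ht
  · simp [plusPlus]
  · obtain ⟨u, hu, hul, rfl, hu'⟩ := exists_rank_eq t a (by omega)
    obtain ⟨v, hv, hvl, rfl, hv'⟩ := exists_rank_eq t b (by omega)
    rw [← hu', ← hv']
    exact rank_concat_zero_le hu hv (by omega) h

theorem rank_lt_of_concat_lt_plusPlus {u : List ℕ} {i a b : ℕ} (hu : Desc (u ++ [i]))
    (hlen : 1 ≤ u.length) (hb : b ≤ plusPlus a u.length) (h : rank (u ++ [i]) < b) :
    rank u < a := by
  obtain ⟨v, hv, hvl, rfl, hv'⟩ := exists_rank_eq u.length a (by omega)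
  by_contra! hle
  have h1 := rank_concat_zero_le hv (desc_concat.1 hu).1 hvl hle
  have h2 : rank (u ++ [0]) ≤ rank (u ++ [i]) := by
    apply rank_mono
    exact List.rel_append (List.forall₂_same.2 fun _ _ => le_rfl) (by simp)
  omega

theorem bijOn_rank (t a : ℕ) (ht : t = 0 → a ≤ 1) :
    Set.BijOn rank {u | Desc u ∧ u.length = t ∧ rank u < a} (Set.Iio a) := by
  refine ⟨fun u hu => hu.2.2, ?_, ?_⟩
  · intro u hu v hv h
    exact rank_injective hu.1 hv.1 (hu.2.1.trans hv.2.1.symm) h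
  · intro b hb
    simp only [Set.mem_Iio] at hb
    obtain ⟨u, hu, hul, hr, -⟩ := exists_rank_eq t b (by omega)
    exact ⟨u, ⟨hu, hul, hr ▸ hb⟩, hr⟩

theorem ncard_rank_lt (t a : ℕ) (ht : t = 0 → a ≤ 1) :
    {u | Desc u ∧ u.length = t ∧ rank u < a}.ncard = a := by
  rw [Set.ncard_congr (t := Set.Iio a) (fun u _ => rank u) (bijOn_rank t a ht).mapsTo
    (fun u v hu hv h => (bijOn_rank t a ht).injOn hu hv h)
    (fun b hb => by simpa using (bijOn_rank t a ht).surjOn hb)]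
  rw [← Nat.card_coe_set_eq]
  simp

theorem finite_rank_lt (t a : ℕ) : {u | Desc u ∧ u.length = t ∧ rank u < a}.Finite :=
  Set.Finite.of_finite_image (f := rank)
    ((Set.finite_Iio a).subset (by rintro _ ⟨u, hu, rfl⟩; exact hu.2.2))
    (fun u hu v hv h => rank_injective hu.1 hv.1 (hu.2.1.trans hv.2.1.symm) h)

/-! ## Stable sets of monomials of a given degree -/

/-- `N` is a finite set of monomials of degree `t` whose complement is closed upwards in the
Borel order. -/
structure IsStable (t : ℕ) (N : Set (List ℕ)) : Prop where
  desc : ∀ u ∈ N, Desc u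
  length : ∀ u ∈ N, u.length = t
  finite : N.Finite
  lower : ∀ u ∈ N, ∀ v, Desc v → List.Forall₂ (· ≤ ·) v u → v ∈ N

theorem map_add_injective (i : ℕ) : Function.Injective (List.map (· + i)) :=
  List.map_injective_iff.2 (add_left_injective i)

theorem concat_injective (i : ℕ) : Function.Injective (fun u : List ℕ => u ++ [i]) :=
  fun _ _ h => List.append_cancel_right h

theorem exists_map_add_eq {l : List ℕ} {i : ℕ} (h : ∀ y ∈ l, i ≤ y) :
    ∃ p : List ℕ, p.map (· + i) = l := by
  refine ⟨l.map (· - i), ?_⟩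
  rw [List.map_map]
  conv_rhs => rw [← List.map_id l]
  exact List.map_congr_left fun y hy => Nat.sub_add_cancel (h y hy)

theorem forall₂_map_add {u v : List ℕ} (i : ℕ) :
    List.Forall₂ (· ≤ ·) (u.map (· + i)) (v.map (· + i)) ↔ List.Forall₂ (· ≤ ·) u v := by
  simp [List.forall₂_map_left_iff, List.forall₂_map_right_iff]

theorem forall₂_concat {u v : List ℕ} {i j : ℕ} (h : List.Forall₂ (· ≤ ·) u v) (hij : i ≤ j) :
    List.Forall₂ (· ≤ ·) (u ++ [i]) (v ++ [j]) :=
  List.rel_append h (by simpa using hij)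

theorem forall₂_refl (u : List ℕ) : List.Forall₂ (· ≤ ·) u u :=
  List.forall₂_same.2 fun _ _ => le_rfl

theorem IsStable.succ {t : ℕ} {N : Set (List ℕ)} (hN : IsStable t N) :
    IsStable t {u : List ℕ | u.map (· + 1) ∈ N} where
  desc u hu := (desc_map_add 1).1 (hN.desc _ hu)
  length u hu := by simpa using hN.length _ hu
  finite := hN.finite.preimage (map_add_injective 1).injOn
  lower u hu v hv h := hN.lower _ hu _ ((desc_map_add 1).2 hv) ((forall₂_map_add 1).2 h)

/-- The quotients by the `i`-th variable of the monomials of `N` whose smallest variable is the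
`i`-th one, with indices shifted by `i`. -/
def minQuot (N : Set (List ℕ)) (i : ℕ) : Set (List ℕ) := {u : List ℕ | u.map (· + i) ++ [i] ∈ N}

theorem mem_quot_zero {N : Set (List ℕ)} {u : List ℕ} : u ∈ minQuot N 0 ↔ u ++ [0] ∈ N := by
  simp [minQuot]

theorem desc_map_add_concat {u : List ℕ} (i : ℕ) : Desc (u.map (· + i) ++ [i]) ↔ Desc u := by
  simp [desc_concat, desc_map_add]

theorem IsStable.quot {t : ℕ} {N : Set (List ℕ)} (hN : IsStable (t + 1) N) (i : ℕ) :
    IsStable t (minQuot N i) where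
  desc u hu := (desc_map_add_concat i).1 (hN.desc _ hu)
  length u hu := by simpa using hN.length _ hu
  finite := hN.finite.preimage ((concat_injective i).comp (map_add_injective i)).injOn
  lower u hu v hv h := hN.lower _ hu _ ((desc_map_add_concat i).2 hv)
    (forall₂_concat ((forall₂_map_add i).2 h) le_rfl)

theorem quot_succ_subset {t : ℕ} {N : Set (List ℕ)} (hN : IsStable (t + 1) N) (i : ℕ) :
    minQuot N (i + 1) ⊆ {u : List ℕ | u.map (· + 1) ∈ minQuot N i} := by
  intro u hu
  refine hN.lower _ hu _ ((desc_map_add_concat i).2 ((desc_map_add 1).2 ?_)) ?_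
  · exact (desc_map_add_concat _).1 (hN.desc _ hu)
  · refine forall₂_concat ?_ (Nat.le_succ i)
    rw [List.map_map]
    have : (fun x => x + i) ∘ (fun x => x + 1) = fun x => x + (i + 1) := by
      ext x; simp; ring
    rw [this]
    exact forall₂_refl _

theorem IsStable.ncard_eq {t : ℕ} {N : Set (List ℕ)} (hN : IsStable (t + 1) N) :
    N.ncard = (minQuot N 0).ncard + {u : List ℕ | u.map (· + 1) ∈ N}.ncard := by
  have h : N = (fun u => u ++ [0]) '' minQuot N 0 ∪
      List.map (· + 1) '' {u : List ℕ | u.map (· + 1) ∈ N} := by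
    ext u
    constructor
    · intro hu
      obtain rfl | ⟨p, i, rfl⟩ := List.eq_nil_or_concat' u
      · simpa using hN.length _ hu
      cases i with
      | zero => exact Or.inl ⟨p, mem_quot_zero.2 hu, rfl⟩
      | succ i =>
        have hd := desc_concat.1 (hN.desc _ hu)
        obtain ⟨q, hq⟩ := exists_map_add_eq (l := p ++ [i + 1]) (i := 1) (by
          intro y hy
          rcases List.mem_append.1 hy with hy | hy
          · have := hd.2 y hy; omega
          · simp at hy; omega)
        exact Or.inr ⟨q, by simpa [hq] using hu, hq⟩
    · rintro (⟨p, hp, rfl⟩ | ⟨p, hp, rfl⟩)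
      · exact mem_quot_zero.1 hp
      · exact hp
  conv_lhs => rw [h]
  rw [Set.ncard_union_eq ?_ ((hN.quot 0).finite.image _) (hN.succ.finite.image _),
    Set.ncard_image_of_injective _ (concat_injective 0),
    Set.ncard_image_of_injective _ (map_add_injective 1)]
  · rw [Set.disjoint_left]
    rintro _ ⟨p, -, rfl⟩ ⟨q, -, hq⟩
    have : 0 ∈ q.map (· + 1) := by rw [hq]; simp
    simp at this

/-- The bound on `|N|` in terms of its part not divisible by the smallest variable implies the
bound on the part divisible by it. -/
theorem rank_lt_ncard_quot {t : ℕ} {N : Set (List ℕ)} (hN : IsStable (t + 1) N)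
    (hG : ∀ b, Desc b → b.length = t + 1 → rank b < {u : List ℕ | u.map (· + 1) ∈ N}.ncard →
      rank (b.map (· + 1)) < N.ncard)
    {c : List ℕ} {y : ℕ} (hc : Desc (c ++ [y])) (hlen : c.length = t)
    (h : rank (c ++ [y]) < N.ncard) : rank c < (minQuot N 0).ncard := by
  obtain ⟨b, hb, hbl, hbr, -⟩ := exists_rank_eq (t + 1) (N.ncard - 1) (by omega)
  obtain rfl | ⟨d, z, rfl⟩ := List.eq_nil_or_concat' b
  · simp at hbl
  have hdl : d.length = t := by simpa using hbl
  have hcd := rank_le_of_concat_le hc hb (by omega) (by omega)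
  suffices rank d < (minQuot N 0).ncard by omega
  have hcard := hN.ncard_eq
  by_contra! hle
  cases z with
  | zero =>
    have h1 := rank_concat_zero d
    have hp := desc_map_pred hb
    have h2 := hG _ hp (by simp [hdl]) (by omega)
    have h3 : rank (d ++ [0 + 1]) ≤ rank (((d ++ [0]).map (· - 1)).map (· + 1)) := by
      apply rank_mono
      simp only [List.map_append, List.map_map, List.map_cons, List.map_nil]
      refine forall₂_concat ?_ (by simp)
      rw [List.forall₂_map_right_iff]
      exact List.forall₂_same.2 fun x _ => by simp only [Function.comp]; omega
    rw [rank_concat_succ] at h3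
    omega
  | succ z =>
    have hd := desc_concat.1 hb
    obtain ⟨e, rfl⟩ := exists_map_add_eq (l := d) (i := 1)
      (fun y hy => by have := hd.2 y hy; omega)
    have hez : e.map (· + 1) ++ [z + 1] = (e ++ [z]).map (· + 1) := by simp
    rw [hez] at hb hbr
    have hb' := (desc_map_add 1).1 hb
    have h1 := rank_map_succ_concat e z
    have hel : (e ++ [z]).length = t + 1 := by simpa using hdl
    obtain ⟨f, hf, hfl, hfr, -⟩ := exists_rank_eq (t + 1) (rank (e ++ [z]) + 1) (by omega)
    have h2 := hG f hf hfl (by omega)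
    have h3 := rank_map_succ_lt hb' hf (by omega) (by omega)
    omega

theorem rank_map_succ_lt_ncard (v t : ℕ) {N : Set (List ℕ)} (hN : IsStable t N)
    (hv : ∀ u ∈ N, ∀ x ∈ u, x < v) {b : List ℕ} (hb : Desc b) (hbl : b.length = t)
    (h : rank b < {u : List ℕ | u.map (· + 1) ∈ N}.ncard) : rank (b.map (· + 1)) < N.ncard := by
  induction v generalizing t N b with
  | zero =>
    have hne : {u : List ℕ | u.map (· + 1) ∈ N}.Nonempty := Set.nonempty_of_ncard_ne_zero (by omega)
    obtain ⟨u, hu⟩ := hne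
    have hnil : u = [] := by
      rw [List.eq_nil_iff_forall_not_mem]
      intro x hx
      exact absurd (hv _ hu (x + 1) (List.mem_map_of_mem hx)) (by simp)
    subst hnil
    have ht := hN.length _ hu
    simp only [List.map_nil, List.length_nil] at ht
    subst ht
    rw [List.length_eq_zero_iff] at hbl
    subst hbl
    simpa [rank] using (Set.ncard_pos hN.finite).2 ⟨_, hu⟩
  | succ v ihv =>
    induction t generalizing N b with
    | zero =>
      rw [List.length_eq_zero_iff] at hbl
      subst hbl
      have hne : {u : List ℕ | u.map (· + 1) ∈ N}.Nonempty :=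
        Set.nonempty_of_ncard_ne_zero (by omega)
      obtain ⟨u, hu⟩ := hne
      simpa [rank] using (Set.ncard_pos hN.finite).2 ⟨_, hu⟩
    | succ t iht =>
      obtain rfl | ⟨c, y, rfl⟩ := List.eq_nil_or_concat' b
      · simp at hbl
      have hcl : c.length = t := by simpa using hbl
      have hB := hN.succ
      have h1 : rank c < (minQuot {u : List ℕ | u.map (· + 1) ∈ N} 0).ncard := by
        refine rank_lt_ncard_quot hB (fun b hb hbl hr => ?_) hb hcl h
        refine ihv (t + 1) hB (fun u hu x hx => ?_) hb hbl hr
        have := hv _ hu (x + 1) (List.mem_map_of_mem hx)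
        omega
      have h2 : minQuot {u : List ℕ | u.map (· + 1) ∈ N} 0 ⊆
          {u : List ℕ | u.map (· + 1) ∈ minQuot N 0} := by
        intro u hu
        rw [mem_quot_zero] at hu
        show _ ∈ minQuot N 0
        rw [mem_quot_zero]
        refine hN.lower _ hu _ ?_ ?_
        · rw [desc_concat_zero, desc_map_add]
          exact desc_concat_zero.1 (hB.desc _ hu)
        · rw [List.map_append]
          exact forall₂_concat (forall₂_refl _) (by simp)
      have h3 := Set.ncard_le_ncard h2 (hN.quot 0).succ.finite
      have h4 := iht (hN.quot 0) (fun u hu x hx => hv _ (mem_quot_zero.1 hu) x (by simp [hx]))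
        (desc_concat.1 hb).1 hcl (by omega)
      have h5 := hN.ncard_eq
      have h6 := rank_map_succ_concat c y
      omega

/-- Green's hyperplane restriction theorem for stable sets. -/
theorem IsStable.rank_map_succ_lt_ncard {t : ℕ} {N : Set (List ℕ)} (hN : IsStable t N)
    {b : List ℕ} (hb : Desc b) (hbl : b.length = t)
    (h : rank b < {u : List ℕ | u.map (· + 1) ∈ N}.ncard) : rank (b.map (· + 1)) < N.ncard := by
  obtain ⟨v, hv⟩ := (hN.finite.image List.sum).bddAbove
  refine _root_.rank_map_succ_lt_ncard (v + 1) t hN (fun u hu x hx => ?_) hb hbl h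
  have h1 := hv (Set.mem_image_of_mem _ hu)
  have h2 := List.single_le_sum (fun _ _ => Nat.zero_le _) x hx
  omega

/-! ## Growth-lexicographic sets -/

/-- The monomials of degree `t + 1` whose quotients by their smallest variable form initial
segments of the same sizes as those of `N`. -/
def growthLex (t : ℕ) (N : Set (List ℕ)) : Set (List ℕ) :=
  {v | ∃ p i, v = p.map (· + i) ++ [i] ∧ Desc p ∧ p.length = t ∧ rank p < (minQuot N i).ncard}

theorem quot_growthLex (t : ℕ) (N : Set (List ℕ)) (i : ℕ) :
    minQuot (growthLex t N) i = {p | Desc p ∧ p.length = t ∧ rank p < (minQuot N i).ncard} := by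
  ext p
  constructor
  · rintro ⟨q, j, h, hq⟩
    obtain ⟨h1, h2⟩ := List.append_inj' h rfl
    have hij : i = j := by simpa using h2
    subst hij
    rw [map_add_injective i h1]
    exact hq
  · rintro hp
    exact ⟨p, i, rfl, hp⟩

theorem rank_map_add_lt_ncard_quot {t : ℕ} {N : Set (List ℕ)} (hN : IsStable (t + 1) N)
    {p : List ℕ} (hp : Desc p) (hpl : p.length = t) (i d : ℕ)
    (h : rank p < (minQuot N (i + d)).ncard) : rank (p.map (· + d)) < (minQuot N i).ncard := by
  induction d generalizing p with
  | zero => simpa using h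
  | succ d ih =>
    have h1 : rank (p.map (· + 1)) < (minQuot N (i + d)).ncard := by
      refine (hN.quot _).rank_map_succ_lt_ncard hp hpl (h.trans_le ?_)
      exact Set.ncard_le_ncard (quot_succ_subset hN (i + d)) (hN.quot _).succ.finite
    have h2 := ih ((desc_map_add 1).2 hp) (by simpa using hpl) h1
    rw [List.map_map] at h2
    have : (fun x => x + d) ∘ (fun x => x + 1) = fun x => x + (d + 1) := by
      ext x; simp; ring
    rwa [this] at h2

theorem growthLex_lower {t : ℕ} {N : Set (List ℕ)} (hN : IsStable (t + 1) N)
    {u v : List ℕ} (hu : u ∈ growthLex t N) (hv : Desc v) (h : List.Forall₂ (· ≤ ·) v u) :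
    v ∈ growthLex t N := by
  obtain ⟨p, i, rfl, hp, hpl, hr⟩ := hu
  obtain rfl | ⟨r, j, rfl⟩ := List.eq_nil_or_concat' v
  · simpa using h.length_eq
  have hv' := desc_concat.1 hv
  obtain ⟨s, rfl⟩ := exists_map_add_eq hv'.2
  have hsl : s.length = p.length := by simpa using h.length_eq
  have h1 := List.forall₂_take s.length h
  have h2 := List.forall₂_drop s.length h
  rw [List.take_left' (by simp), List.take_left' (by simp [hsl])] at h1
  rw [List.drop_left' (by simp), List.drop_left' (by simp [hsl])] at h2
  have hji : j ≤ i := by simpa using h2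
  obtain ⟨d, rfl⟩ := Nat.exists_eq_add_of_le hji
  refine ⟨s, j, rfl, (desc_map_add j).1 hv'.1, by omega, ?_⟩
  refine lt_of_le_of_lt (rank_mono ?_) (rank_map_add_lt_ncard_quot hN hp hpl j d hr)
  rw [← forall₂_map_add j, List.map_map]
  have : (fun x => x + j) ∘ (fun x => x + d) = fun x => x + (j + d) := by
    ext x; simp; ring
  rwa [this]

theorem rank_lt_of_mem_growthLex {t : ℕ} {N : Set (List ℕ)} (hN : IsStable (t + 1) N)
    {p : List ℕ} {i : ℕ} (h : p ++ [i] ∈ growthLex t N) : rank p < (minQuot N 0).ncard := by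
  obtain ⟨q, j, h1, hq, hql, hr⟩ := h
  obtain ⟨h2, -⟩ := List.append_inj' h1 rfl
  rw [h2]
  exact rank_map_add_lt_ncard_quot hN hq hql 0 j (by simpa using hr)

theorem desc_of_mem_growthLex {t : ℕ} {N : Set (List ℕ)} {u : List ℕ} (h : u ∈ growthLex t N) :
    Desc u ∧ u.length = t + 1 := by
  obtain ⟨p, i, rfl, hp, hpl, -⟩ := h
  exact ⟨(desc_map_add_concat i).2 hp, by simpa using hpl⟩

/-! ## Order ideals of monomials -/

/-- The complement of a strongly stable ideal, as a set of descending lists. -/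
structure IsStableOrderIdeal (N : Set (List ℕ)) : Prop where
  desc : ∀ u ∈ N, Desc u
  of_concat_mem : ∀ u i, u ++ [i] ∈ N → u ∈ N
  lower : ∀ u ∈ N, ∀ v, Desc v → List.Forall₂ (· ≤ ·) v u → v ∈ N

theorem Desc.take {u : List ℕ} (hu : Desc u) (k : ℕ) : Desc (u.take k) :=
  List.Pairwise.take hu

theorem IsStableOrderIdeal.take {N : Set (List ℕ)} (hN : IsStableOrderIdeal N) {u : List ℕ}
    (hu : u ∈ N) (k : ℕ) : u.take k ∈ N := by
  induction u using List.reverseRecOn with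
  | nil => simpa using hu
  | append_singleton p i ih =>
    rcases le_or_gt (p ++ [i]).length k with h | h
    · rwa [List.take_of_length_le h]
    · rw [List.take_append_of_le_length (by simp at h; omega)]
      exact ih (hN.of_concat_mem p i hu)

theorem IsStableOrderIdeal.take_mem_iff {N : Set (List ℕ)} (hN : IsStableOrderIdeal N) {R : ℕ}
    (hR : ∀ p i, R ≤ p.length → Desc (p ++ [i]) → p ∈ N → p ++ [i] ∈ N) {u : List ℕ}
    (hu : Desc u) : u.take R ∈ N ↔ u ∈ N := by
  refine ⟨fun h => ?_, fun h => hN.take h R⟩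
  induction u using List.reverseRecOn with
  | nil => simpa using h
  | append_singleton p i ih =>
    rcases le_or_gt (p ++ [i]).length R with hle | hlt
    · rwa [List.take_of_length_le hle] at h
    · have hp : R ≤ p.length := by simp at hlt; omega
      rw [List.take_append_of_le_length hp] at h
      exact hR p i hp hu (ih (desc_concat.1 hu).1 h)

theorem IsStableOrderIdeal.isStable {N : Set (List ℕ)} (hN : IsStableOrderIdeal N) {t : ℕ}
    (hfin : {u ∈ N | u.length = t}.Finite) : IsStable t {u ∈ N | u.length = t} where
  desc u hu := hN.desc u hu.1
  length _ hu := hu.2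
  finite := hfin
  lower u hu v hv h := ⟨hN.lower u hu.1 v hv h, h.length_eq.trans hu.2⟩

/-- The order ideal which is lexicographic with `D t` elements in every degree `t < R`, and in
degrees at least `R` consists of the descending lists extending an element of `A`. -/
def graft (R : ℕ) (D : ℕ → ℕ) (A : Set (List ℕ)) : Set (List ℕ) :=
  {u | Desc u ∧ (u.length < R → rank u < D u.length) ∧ (R ≤ u.length → u.take R ∈ A)}

theorem isStableOrderIdeal_graft {R : ℕ} {D : ℕ → ℕ} {A : Set (List ℕ)} (hD0 : 1 ≤ D 0)
    (hD : ∀ t, 1 ≤ t → t + 1 < R → D (t + 1) ≤ plusPlus (D t) t)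
    (hlow : ∀ u ∈ A, ∀ v, Desc v → List.Forall₂ (· ≤ ·) v u → v ∈ A)
    (hA : ∀ p i, p ++ [i] ∈ A → p.length + 1 = R → rank p < D p.length) :
    IsStableOrderIdeal (graft R D A) where
  desc u hu := hu.1
  of_concat_mem p i hu := by
    obtain ⟨h1, h2, h3⟩ := hu
    refine ⟨(desc_concat.1 h1).1, fun hlt => ?_, fun hle => ?_⟩
    · rcases Nat.lt_or_ge (p.length + 1) R with h | h
      · rcases Nat.eq_zero_or_pos p.length with hp | hp
        · rw [hp]
          rw [List.length_eq_zero_iff] at hp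
          subst hp
          simpa [rank] using Nat.pos_of_ne_zero (by omega)
        · simp only [List.length_append, List.length_cons, List.length_nil, zero_add] at h2
          exact rank_lt_of_concat_lt_plusPlus h1 hp (hD _ hp h) (h2 h)
      · have hR : (p ++ [i]).length = R := by simp; omega
        have h4 := h3 hR.ge
        rw [List.take_of_length_le hR.le] at h4
        exact hA p i h4 (by simpa using hR)
    · have h4 := h3 (by simp; omega)
      rwa [List.take_append_of_le_length hle] at h4
  lower u hu v hv h := by
    obtain ⟨h1, h2, h3⟩ := hu
    refine ⟨hv, fun hlt => ?_, fun hle => ?_⟩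
    · rw [h.length_eq] at hlt ⊢
      exact (rank_mono h).trans_lt (h2 hlt)
    · rw [h.length_eq] at hle
      exact hlow _ (h3 hle) _ (hv.take R) (List.forall₂_take R h)

theorem concat_mem_graft {R : ℕ} {D : ℕ → ℕ} {A : Set (List ℕ)} {p : List ℕ} {i : ℕ}
    (hp : R ≤ p.length) (h : Desc (p ++ [i])) (hpA : p ∈ graft R D A) :
    p ++ [i] ∈ graft R D A := by
  refine ⟨h, fun hlt => ?_, fun _ => ?_⟩
  · simp at hlt; omega
  · rw [List.take_append_of_le_length hp]
    exact hpA.2.2 hp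

theorem ncard_graft_of_lt {R t : ℕ} {D : ℕ → ℕ} {A : Set (List ℕ)} (hD0 : D 0 ≤ 1)
    (ht : t < R) : {u ∈ graft R D A | u.length = t}.ncard = D t := by
  rw [← ncard_rank_lt t (D t) (by rintro rfl; exact hD0)]
  congr 1
  ext u
  constructor
  · rintro ⟨⟨h1, h2, -⟩, rfl⟩
    exact ⟨h1, rfl, h2 ht⟩
  · rintro ⟨h1, rfl, h2⟩
    exact ⟨⟨h1, fun _ => h2, fun h => by omega⟩, rfl⟩

/-- The number of extensions of the elements of a set of monomials depends only on the
numbers of its elements with given smallest variable. -/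
theorem encard_extensions_le {s : ℕ} {A B : Set (List ℕ)}
    (hA : ∀ u ∈ A, Desc u ∧ u.length = s + 1) (hB : ∀ u ∈ B, Desc u ∧ u.length = s + 1)
    (hfin : ∀ i, (minQuot A i).Finite)
    (hle : ∀ i, (minQuot A i).encard ≤ (minQuot B i).encard) (t : ℕ) :
    {u | Desc u ∧ u.length = t ∧ u.take (s + 1) ∈ A}.encard ≤
      {u | Desc u ∧ u.length = t ∧ u.take (s + 1) ∈ B}.encard := by
  choose f hf hinj using fun i => (hfin i).exists_injOn_of_encard_le (hle i)
  have key : ∀ u, Desc u → u.take (s + 1) ∈ A → ∃ p i, p ∈ minQuot A i ∧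
      u = p.map (· + i) ++ [i] ++ u.drop (s + 1) := by
    intro u hu hm
    obtain ⟨hd, hl⟩ := hA _ hm
    obtain h | ⟨r, i, h⟩ := List.eq_nil_or_concat' (u.take (s + 1))
    · rw [h] at hl; simp at hl
    · rw [h] at hd
      obtain ⟨p, rfl⟩ := exists_map_add_eq (desc_concat.1 hd).2
      exact ⟨p, i, by rw [h] at hm; exact hm, by rw [← h, List.take_append_drop]⟩
  choose! P I hP hPI using key
  have hlenP : ∀ u, Desc u → u.take (s + 1) ∈ A →
      (((P u).map (· + I u)) ++ [I u]).length = s + 1 := fun u h1 h2 =>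
    (hA _ (hP u h1 h2)).2
  have hQ : ∀ u, Desc u → u.take (s + 1) ∈ A →
      (f (I u) (P u)).map (· + I u) ++ [I u] ∈ B := fun u h1 h2 => hf (I u) (hP u h1 h2)
  refine Set.encard_le_encard_of_injOn
    (f := fun u => (f (I u) (P u)).map (· + I u) ++ [I u] ++ u.drop (s + 1)) ?_ ?_
  · rintro u ⟨h1, h2, h3⟩
    have hlQ := (hB _ (hQ u h1 h3)).2
    have h4 := hPI u h1 h3
    have h5 := hlenP u h1 h3
    refine ⟨?_, ?_, ?_⟩
    · have h6 := (hB _ (hQ u h1 h3)).1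
      rw [h4] at h1
      refine List.pairwise_append.2 ⟨h6, (List.pairwise_append.1 h1).2.1, fun a ha b hb => ?_⟩
      have hab : I u ≤ a := by
        rcases List.mem_append.1 ha with ha | ha
        · exact (desc_concat.1 h6).2 a ha
        · simp at ha; omega
      exact ((List.pairwise_append.1 h1).2.2 (I u) (by simp) b hb).trans hab
    · rw [List.length_append, hlQ]
      rw [h4, List.length_append, h5] at h2
      exact h2
    · rw [List.take_left' hlQ]
      exact hQ u h1 h3
  · rintro u ⟨h1, h2, h3⟩ v ⟨h1', h2', h3'⟩ huv
    have hlQ := (hB _ (hQ u h1 h3)).2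
    have hlQ' := (hB _ (hQ v h1' h3')).2
    obtain ⟨h4, h5⟩ := List.append_inj huv (hlQ.trans hlQ'.symm)
    obtain ⟨h6, h7⟩ := List.append_inj' h4 rfl
    have hI : I u = I v := by simpa using h7
    rw [hI] at h6
    have hPu := hP u h1 h3
    rw [hI] at hPu
    have hPP := hinj (I v) hPu (hP v h1' h3') (map_add_injective _ h6)
    rw [hPI u h1 h3, hPI v h1' h3', hI, hPP, h5]

theorem ncard_graft_growthLex {s t : ℕ} {D : ℕ → ℕ} {N : Set (List ℕ)} (hs : 1 ≤ s)
    (ht : s + 1 ≤ t) (hN : IsStableOrderIdeal N)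
    (hfin : {u ∈ N | u.length = s + 1}.Finite)
    (hR : ∀ p i, s + 1 ≤ p.length → Desc (p ++ [i]) → p ∈ N → p ++ [i] ∈ N) :
    {u ∈ graft (s + 1) D (growthLex s {u ∈ N | u.length = s + 1}) | u.length = t}.ncard =
      {u ∈ N | u.length = t}.ncard := by
  have hst := hN.isStable hfin
  have hcard : ∀ i, (minQuot (growthLex s {u ∈ N | u.length = s + 1}) i).encard =
      (minQuot {u ∈ N | u.length = s + 1} i).encard := by
    intro i
    rw [quot_growthLex, ← (finite_rank_lt _ _).cast_ncard_eq, ← (hst.quot i).finite.cast_ncard_eq,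
      ncard_rank_lt _ _ (by omega)]
  have h1 : {u ∈ graft (s + 1) D (growthLex s {u ∈ N | u.length = s + 1}) | u.length = t} =
      {u | Desc u ∧ u.length = t ∧
        u.take (s + 1) ∈ growthLex s {u ∈ N | u.length = s + 1}} := by
    ext u
    constructor
    · rintro ⟨⟨h1, -, h2⟩, rfl⟩
      exact ⟨h1, rfl, h2 ht⟩
    · rintro ⟨h1, rfl, h2⟩
      exact ⟨⟨h1, fun h => by omega, fun _ => h2⟩, rfl⟩
  have h2 : {u ∈ N | u.length = t} =
      {u | Desc u ∧ u.length = t ∧ u.take (s + 1) ∈ {u ∈ N | u.length = s + 1}} := by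
    ext u
    constructor
    · rintro ⟨h, rfl⟩
      exact ⟨hN.desc u h, rfl, hN.take h _, by simpa using ht⟩
    · rintro ⟨h, rfl, h'⟩
      exact ⟨(hN.take_mem_iff hR h).1 h'.1, rfl⟩
  rw [h1, h2, Set.ncard, Set.ncard]
  congr 1
  refine le_antisymm ?_ ?_
  · refine encard_extensions_le (fun u hu => desc_of_mem_growthLex hu)
      (fun u hu => ⟨hst.desc u hu, hst.length u hu⟩) (fun i => ?_) (fun i => (hcard i).le) t
    rw [quot_growthLex]
    exact finite_rank_lt _ _
  · exact encard_extensions_le (fun u hu => ⟨hst.desc u hu, hst.length u hu⟩)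
      (fun u hu => desc_of_mem_growthLex hu) (fun i => (hst.quot i).finite)
      (fun i => (hcard i).ge) t

/-! ## Monomials and descending lists -/

theorem forall₂_take_of_countP_le {u v : List ℕ} (hu : Desc u) (hv : Desc v)
    (h : ∀ k, u.countP (k ≤ ·) ≤ v.countP (k ≤ ·)) :
    List.Forall₂ (· ≤ ·) u (v.take u.length) := by
  induction u generalizing v with
  | nil => simp
  | cons x l ih =>
    have hx : 0 < v.countP (x ≤ ·) := lt_of_lt_of_le (by simp) (h x)
    obtain ⟨z, hz, hxz⟩ := List.countP_pos_iff.1 hx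
    simp only [decide_eq_true_eq] at hxz
    cases v with
    | nil => simp at hz
    | cons y r =>
      rw [desc_cons] at hu hv
      have hxy : x ≤ y := by
        rcases List.mem_cons.1 hz with rfl | hz
        · exact hxz
        · exact hxz.trans (hv.1 z hz)
      refine List.Forall₂.cons hxy (ih hu.2 hv.2 fun k => ?_)
      rcases le_or_gt k x with hk | hk
      · have := h k
        rw [List.countP_cons_of_pos (by simpa using hk),
          List.countP_cons_of_pos (by simpa using hk.trans hxy)] at this
        omega
      · rw [List.countP_eq_zero.2 fun a ha => by simpa using (hu.1 a ha).trans_lt hk]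
        exact Nat.zero_le _

/-- The variables different from `x₀` in a monomial, with multiplicities; `x_{i+1}` is recorded
as `i`. -/
def varMult {n : ℕ} (m : Mon n) : Multiset ℕ :=
  ∑ i : Fin n, Multiset.replicate (m i.succ) i.val

/-- The descending list of the variables different from `x₀` in a monomial. -/
def toList {n : ℕ} (m : Mon n) : List ℕ := (varMult m).sort (· ≥ ·)

/-- The monomial without `x₀` whose variables are those of the given list. -/
def ofList (n : ℕ) (u : List ℕ) : Mon n := Fin.cases 0 fun i : Fin n => u.count i.val

@[simp]
theorem ofList_zero (n : ℕ) (u : List ℕ) : ofList n u 0 = 0 := rfl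

@[simp]
theorem ofList_succ {n : ℕ} (u : List ℕ) (i : Fin n) : ofList n u i.succ = u.count i.val := rfl

theorem ofList_append (n : ℕ) (u v : List ℕ) : ofList n (u ++ v) = ofList n u + ofList n v := by
  funext l
  cases l using Fin.cases <;> simp

theorem desc_toList {n : ℕ} (m : Mon n) : Desc (toList m) := Multiset.pairwise_sort _ _

theorem lt_of_mem_toList {n : ℕ} {m : Mon n} {x : ℕ} (h : x ∈ toList m) : x < n := by
  rw [toList, Multiset.mem_sort, varMult, Multiset.mem_sum] at h
  obtain ⟨i, -, hi⟩ := h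
  rw [Multiset.eq_of_mem_replicate hi]
  exact i.2

theorem count_toList {n : ℕ} (m : Mon n) (i : Fin n) : (toList m).count i.val = m i.succ := by
  rw [← Multiset.coe_count, toList, Multiset.sort_eq, varMult, Multiset.count_sum']
  simp [Multiset.count_replicate, Fin.val_inj]

theorem countP_toList {n : ℕ} (m : Mon n) (k : ℕ) :
    (toList m).countP (k ≤ ·) = ∑ i : Fin n, if k ≤ i.val then m i.succ else 0 := by
  rw [← Multiset.coe_countP, toList, Multiset.sort_eq, varMult,
    ← Multiset.coe_countPAddMonoidHom, map_sum]
  refine Finset.sum_congr rfl fun i _ => ?_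
  simp [← Multiset.coe_replicate, List.countP_replicate]

theorem mdeg_eq {n : ℕ} (m : Mon n) : mdeg m = m 0 + (toList m).length := by
  rw [mdeg, Fin.sum_univ_succ, toList, Multiset.length_sort, varMult, Multiset.card_sum]
  simp

theorem toList_eq {n : ℕ} {m : Mon n} {u : List ℕ} (hu : Desc u) (hlt : ∀ x ∈ u, x < n)
    (h : ∀ i : Fin n, u.count i.val = m i.succ) : toList m = u := by
  refine List.Perm.eq_of_pairwise' (desc_toList m) hu (List.perm_iff_count.2 fun x => ?_)
  rcases lt_or_ge x n with hx | hx
  · rw [count_toList m ⟨x, hx⟩, ← h]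
  · rw [List.count_eq_zero_of_not_mem fun hm => (lt_of_mem_toList hm).not_ge hx,
      List.count_eq_zero_of_not_mem fun hm => (hlt x hm).not_ge hx]

theorem toList_congr {n : ℕ} {m m' : Mon n} (h : ∀ i : Fin n, m i.succ = m' i.succ) :
    toList m = toList m' :=
  toList_eq (desc_toList m') (fun _ => lt_of_mem_toList) fun i => by rw [count_toList, h]

theorem toList_ofList {n : ℕ} {u : List ℕ} (hu : Desc u) (hlt : ∀ x ∈ u, x < n) :
    toList (ofList n u) = u :=
  toList_eq hu hlt fun _ => rfl

/-- The monomials whose part without `x₀` does not belong to `N`. -/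
def idealOf (n : ℕ) (N : Set (List ℕ)) : Set (Mon n) := {m | toList m ∉ N}

theorem IsStableOrderIdeal.toList_mem {n : ℕ} {N : Set (List ℕ)} (hN : IsStableOrderIdeal N)
    {m m' : Mon n} (hm : toList m ∈ N)
    (h : ∀ k : ℕ, (∑ i : Fin n, if k ≤ i.val then m' i.succ else 0) ≤
      ∑ i : Fin n, if k ≤ i.val then m i.succ else 0) : toList m' ∈ N := by
  refine hN.lower _ (hN.take hm (toList m').length) _ (desc_toList m') ?_
  refine forall₂_take_of_countP_le (desc_toList m') (desc_toList m) fun k => ?_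
  simpa only [countP_toList] using h k

theorem IsStableOrderIdeal.stronglyStable_idealOf {N : Set (List ℕ)}
    (hN : IsStableOrderIdeal N) (n : ℕ) : StronglyStable (idealOf n N) := by
  refine ⟨fun m hm m' h => hm (hN.toList_mem h fun k => ?_), fun m hm j i hji hj h =>
    hm (hN.toList_mem h fun k => ?_)⟩
  · exact Finset.sum_le_sum fun i _ => by split_ifs <;> simp
  · cases i using Fin.cases with
    | zero => exact absurd hji (Fin.not_lt_zero j)
    | succ i =>
    cases j using Fin.cases with
    | zero =>
      refine Finset.sum_le_sum fun l _ => ?_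
      simp only [borelStep, Fin.succ_ne_zero, if_false]
      split_ifs <;> omega
    | succ j =>
      have hji' : j.val < i.val := by simpa using hji
      have key : (∑ l : Fin n, if k ≤ l.val then m l.succ else 0) + (if k ≤ i.val then 1 else 0) =
          (∑ l : Fin n, if k ≤ l.val then borelStep m j.succ i.succ l.succ else 0) +
            (if k ≤ j.val then 1 else 0) := by
        have e : ∀ a : Fin n, (if k ≤ a.val then 1 else 0) =
            ∑ l : Fin n, if l = a then (if k ≤ l.val then 1 else 0) else 0 := by simp
        rw [e i, e j, ← Finset.sum_add_distrib, ← Finset.sum_add_distrib]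
        refine Finset.sum_congr rfl fun l _ => ?_
        simp only [borelStep, Fin.succ_inj]
        by_cases h1 : l = j
        · subst h1
          have h2 : l ≠ i := fun h => by subst h; omega
          simp only [h2, if_true, if_false]
          split_ifs <;> omega
        · rw [if_neg h1, if_neg h1]
          split_ifs <;> omega
      split_ifs at key <;> omega

theorem monSat_idealOf (n : ℕ) (N : Set (List ℕ)) : monSat (idealOf n N) = idealOf n N := by
  ext m
  refine ⟨fun hm => ?_, fun hm i => ⟨0, by simpa using hm⟩⟩
  obtain ⟨k, hk⟩ := hm 0
  have h : toList (fun l => if l = 0 then m l + k else m l) = toList m :=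
    toList_congr fun i => by simp [Fin.succ_ne_zero]
  rw [idealOf, Set.mem_ofPred_eq, h] at hk
  exact hk

theorem hilb_idealOf {n : ℕ} {N : Set (List ℕ)} (hN : ∀ u ∈ N, Desc u)
    (hlt : ∀ u ∈ N, ∀ x ∈ u, x < n) (t : ℕ) :
    hilb (idealOf n N) t = {u ∈ N | u.length ≤ t}.ncard := by
  refine Set.ncard_congr (fun m _ => toList m) ?_ ?_ ?_
  · rintro m ⟨hm, hmN⟩
    exact ⟨not_not.1 hmN, by have := mdeg_eq m; omega⟩
  · rintro m m' ⟨hm, -⟩ ⟨hm', -⟩ h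
    funext l
    cases l using Fin.cases with
    | zero =>
      have h1 := mdeg_eq m
      have h2 := mdeg_eq m'
      rw [h] at h1
      omega
    | succ i => rw [← count_toList m, ← count_toList m', h]
  · rintro u ⟨hu, hut⟩
    refine ⟨ofList n u + Pi.single 0 (t - u.length), ⟨?_, ?_⟩, ?_⟩
    all_goals
      have h : toList (ofList n u + Pi.single 0 (t - u.length)) = u :=
        toList_eq (hN u hu) (hlt u hu) fun i => by simp [Fin.succ_ne_zero]
    · rw [mdeg_eq, h]
      simp
      omega
    · rw [idealOf, Set.mem_ofPred_eq, h]
      exact not_not.2 hu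
    · exact h

theorem finite_level {n : ℕ} {N : Set (List ℕ)} (hlt : ∀ u ∈ N, ∀ x ∈ u, x < n) (t : ℕ) :
    {u ∈ N | u.length ≤ t}.Finite := by
  refine ((List.finite_length_le (Fin n) t).image (List.map Fin.val)).subset ?_
  rintro u ⟨hu, hut⟩
  refine ⟨u.pmap (fun x hx => (⟨x, hx⟩ : Fin n)) (hlt u hu), by simpa using hut, ?_⟩
  simp [List.map_pmap]

theorem hilb_idealOf_zero {n : ℕ} {N : Set (List ℕ)} (hN : ∀ u ∈ N, Desc u)
    (hlt : ∀ u ∈ N, ∀ x ∈ u, x < n) :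
    hilb (idealOf n N) 0 = {u ∈ N | u.length = 0}.ncard := by
  simp [hilb_idealOf hN hlt]

theorem hilb_idealOf_succ {n : ℕ} {N : Set (List ℕ)} (hN : ∀ u ∈ N, Desc u)
    (hlt : ∀ u ∈ N, ∀ x ∈ u, x < n) (t : ℕ) :
    hilb (idealOf n N) (t + 1) =
      hilb (idealOf n N) t + {u ∈ N | u.length = t + 1}.ncard := by
  rw [hilb_idealOf hN hlt, hilb_idealOf hN hlt, ← Set.ncard_union_eq _ (finite_level hlt t)
    ((finite_level hlt (t + 1)).subset fun u hu => ⟨hu.1, hu.2.le⟩)]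
  · congr 1
    ext u
    simp only [Set.mem_ofPred_eq, Set.mem_union, ← and_or_left, Nat.le_succ_iff]
  · rw [Set.disjoint_left]
    rintro u ⟨-, h⟩ ⟨-, h'⟩
    omega

/-! ## Saturated strongly stable ideals -/

/-- The descending lists of the monomials without `x₀` outside `J`. -/
def orderIdeal {n : ℕ} (J : Set (Mon n)) : Set (List ℕ) :=
  {u | Desc u ∧ (∀ x ∈ u, x < n) ∧ ofList n u ∉ J}

theorem StronglyStable.add_ofList_singleton_mem {n : ℕ} {J : Set (Mon n)} (hJ : StronglyStable J)
    {d : Mon n} {a b : ℕ} (hab : a ≤ b) (hb : b < n) (h : d + ofList n [a] ∈ J) :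
    d + ofList n [b] ∈ J := by
  rcases hab.eq_or_lt with rfl | hab
  · exact h
  · have h1 := hJ.2 _ h (Fin.succ ⟨a, hab.trans hb⟩) (Fin.succ ⟨b, hb⟩) (by simpa using hab)
      (by rw [Pi.add_apply, ofList_succ]; simp)
    convert h1 using 1
    funext l
    cases l using Fin.cases with
    | zero => simp [borelStep]
    | succ l =>
      simp only [borelStep, Fin.val_succ, Fin.ext_iff, Pi.add_apply, ofList_succ,
        List.count_singleton, beq_iff_eq]
      split_ifs <;> omega

theorem StronglyStable.add_ofList_mem {n : ℕ} {J : Set (Mon n)} (hJ : StronglyStable J)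
    {u v : List ℕ} (h : List.Forall₂ (· ≤ ·) v u) (hu : ∀ x ∈ u, x < n) (c : Mon n)
    (hv : c + ofList n v ∈ J) : c + ofList n u ∈ J := by
  induction h generalizing c with
  | nil => exact hv
  | @cons a b v u hab _ ih =>
    rw [← List.singleton_append, ofList_append] at hv ⊢
    have h1 := ih (fun x hx => hu x (List.mem_cons_of_mem b hx)) (c + ofList n [a])
      (by rwa [add_assoc])
    rw [add_right_comm] at h1
    have h2 := hJ.add_ofList_singleton_mem hab (hu b (by simp)) h1
    rwa [add_right_comm, add_assoc] at h2

theorem StronglyStable.isStableOrderIdeal {n : ℕ} {J : Set (Mon n)} (hJ : StronglyStable J) :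
    IsStableOrderIdeal (orderIdeal J) where
  desc u hu := hu.1
  of_concat_mem u i hu := by
    refine ⟨(desc_concat.1 hu.1).1, fun x hx => hu.2.1 x (by simp [hx]), fun h => hu.2.2 ?_⟩
    rw [ofList_append]
    exact hJ.1 _ h _
  lower u hu v hv h := by
    refine ⟨hv, fun x hx => ?_, fun h' => hu.2.2 ?_⟩
    · obtain ⟨k, hk, rfl⟩ := List.mem_iff_getElem.1 hx
      have hk' : k < u.length := h.length_eq ▸ hk
      exact (List.Forall₂.get h hk hk').trans_lt (hu.2.1 _ (List.getElem_mem hk'))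
    · simpa using hJ.add_ofList_mem h hu.2.1 0 (by simpa using h')

theorem StronglyStable.move_zero_mem {n : ℕ} {J : Set (Mon n)} (hJ : StronglyStable J)
    {i : Fin (n + 1)} (hi : i ≠ 0) (k : ℕ) {c : Mon n} (hc : c ∈ J) (hk : c 0 = k) :
    (fun l => if l = 0 then 0 else if l = i then c l + k else c l) ∈ J := by
  induction k generalizing c with
  | zero =>
    convert hc using 1
    funext l
    split_ifs with h1 h2
    · rw [h1, hk]
    · rfl
    · rfl
  | succ k ih =>
    have h1 := ih (hJ.2 c hc 0 i (Fin.pos_of_ne_zero hi) (by omega))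
      (by simp [borelStep, hk])
    convert h1 using 1
    funext l
    simp only [borelStep]
    split_ifs <;> omega

theorem ofList_toList_mem_iff {n : ℕ} {J : Set (Mon n)} (hJ : StronglyStable J)
    (hsat : monSat J = J) (m : Mon n) : ofList n (toList m) ∈ J ↔ m ∈ J := by
  constructor
  · intro h
    convert hJ.1 _ h (Pi.single 0 (m 0)) using 1
    funext l
    cases l using Fin.cases <;> simp [count_toList, Fin.succ_ne_zero]
  · intro h
    rw [← hsat]
    intro i
    refine ⟨m 0, ?_⟩
    by_cases hi : i = 0
    · subst hi
      convert h using 1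
      funext l
      cases l using Fin.cases <;> simp [count_toList, Fin.succ_ne_zero]
    · convert hJ.move_zero_mem hi (m 0) h rfl using 1
      funext l
      cases l using Fin.cases with
      | zero => simp [Ne.symm hi]
      | succ l => simp [count_toList, Fin.succ_ne_zero]

theorem idealOf_orderIdeal {n : ℕ} {J : Set (Mon n)} (hJ : StronglyStable J)
    (hsat : monSat J = J) : idealOf n (orderIdeal J) = J := by
  ext m
  rw [← ofList_toList_mem_iff hJ hsat m, idealOf, Set.mem_ofPred_eq, orderIdeal]
  simp only [Set.mem_ofPred_eq, desc_toList, true_and, not_and, not_not]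
  exact ⟨fun h => h fun x => lt_of_mem_toList, fun h _ => h⟩

/-! ## Regularity -/

theorem finite_isMinGen {n : ℕ} {J : Set (Mon n)} (hJ : MonIdeal J) :
    {m | IsMinGen J m}.Finite := by
  refine IsAntichain.finite_of_partiallyWellOrderedOn (r := (· ≤ ·)) ?_
    (Set.isPWO_of_wellQuasiOrderedLE _)
  intro m hm m' hm' hne hle
  obtain ⟨i, hi⟩ : ∃ i, m i < m' i := by
    by_contra! h
    exact hne (funext fun i => le_antisymm (hle i) (h i))
  refine hm'.2 i (by omega) ?_
  convert hJ m hm.1 (shrinkAt m' i - m) using 1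
  funext l
  have hl : m l ≤ m' l := hle l
  simp only [shrinkAt, Pi.add_apply, Pi.sub_apply]
  split_ifs with h
  · subst h
    omega
  · omega

theorem exists_shrinkAt_mem {n : ℕ} {J : Set (Mon n)} (hJ : MonIdeal J) {m : Mon n} (hm : m ∈ J)
    (h : monReg J < mdeg m) : ∃ i, 1 ≤ m i ∧ shrinkAt m i ∈ J := by
  by_contra! hmin
  refine h.not_ge (le_csSup ?_ ⟨m, ⟨hm, hmin⟩, rfl⟩)
  exact ((finite_isMinGen hJ).image mdeg).bddAbove

theorem StronglyStable.concat_mem_orderIdeal {n : ℕ} {J : Set (Mon n)} (hJ : StronglyStable J)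
    {p : List ℕ} {x : ℕ} (hp : 1 ≤ p.length) (hreg : monReg J ≤ p.length) (h : Desc (p ++ [x]))
    (hpJ : p ∈ orderIdeal J) : p ++ [x] ∈ orderIdeal J := by
  have hx := (desc_concat.1 h).2
  have hlt : ∀ y ∈ p ++ [x], y < n := by
    obtain ⟨z, hz⟩ := List.exists_mem_of_length_pos hp
    intro y hy
    rcases List.mem_append.1 hy with hy | hy
    · exact hpJ.2.1 y hy
    · rw [List.mem_singleton.1 hy]
      exact (hx z hz).trans_lt (hpJ.2.1 z hz)
  refine ⟨h, hlt, fun hmem => ?_⟩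
  obtain ⟨i, hi, hiJ⟩ := exists_shrinkAt_mem hJ.1 hmem
    (by rw [mdeg_eq, toList_ofList h hlt]; simp; omega)
  cases i using Fin.cases with
  | zero => simp at hi
  | succ i =>
    have hi' : i.val ∈ p ++ [x] := List.count_pos_iff.1 hi
    have hxi : x ≤ i.val := by
      rcases List.mem_append.1 hi' with hy | hy
      · exact hx _ hy
      · exact (List.mem_singleton.1 hy).ge
    have hd : Desc ((p ++ [x]).erase i.val) := h.sublist List.erase_sublist
    have hlen : ((p ++ [x]).erase i.val).length = p.length := by
      rw [List.length_erase_of_mem hi']; simp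
    have hmem' : (p ++ [x]).erase i.val ∈ orderIdeal J := by
      refine hJ.isStableOrderIdeal.lower p hpJ _ hd ?_
      have := forall₂_take_of_countP_le hd hpJ.1 fun k => ?_
      · rwa [hlen, List.take_length] at this
      · have h1 := (List.perm_cons_erase hi').countP_eq (k ≤ ·)
        simp only [List.countP_append, List.countP_cons, List.countP_nil,
          decide_eq_true_eq] at h1
        split_ifs at h1 <;> omega
    refine hmem'.2.2 ?_
    convert hiJ using 1
    funext l
    cases l using Fin.cases with
    | zero => simp [shrinkAt]
    | succ l =>
      simp only [shrinkAt, ofList_succ, Fin.val_succ, List.count_erase, beq_iff_eq,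
        Fin.ext_iff]
      split_ifs <;> omega

theorem monReg_idealOf_le {n R : ℕ} {N : Set (List ℕ)}
    (hR : ∀ p i, R ≤ p.length → Desc (p ++ [i]) → p ∈ N → p ++ [i] ∈ N) :
    monReg (idealOf n N) ≤ R := by
  refine csSup_le' ?_
  rintro d ⟨m, ⟨hm, hmin⟩, rfl⟩
  by_contra! hlt
  have h0 : m 0 = 0 := by
    by_contra h
    refine hmin 0 (by omega) ?_
    have h1 : toList (shrinkAt m 0) = toList m :=
      toList_congr fun i => by simp [shrinkAt, Fin.succ_ne_zero]
    rwa [idealOf, Set.mem_ofPred_eq, h1]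
  rw [mdeg_eq, h0, zero_add] at hlt
  obtain h | ⟨p, x, h⟩ := List.eq_nil_or_concat' (toList m)
  · simp [h] at hlt
  · have hx : x < n := lt_of_mem_toList (m := m) (by simp [h])
    have hd := desc_toList m
    have hcount := count_toList m
    have hm' : toList m ∉ N := hm
    rw [h] at hd hcount hlt hm'
    have h1 : toList (shrinkAt m (Fin.succ ⟨x, hx⟩)) = p := by
      refine toList_eq (desc_concat.1 hd).1
        (fun y hy => lt_of_mem_toList (m := m) (by simp [h, hy])) fun i => ?_
      have h2 := hcount i
      rw [List.count_append, List.count_singleton] at h2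
      simp only [shrinkAt, Fin.val_succ, Fin.ext_iff, beq_iff_eq] at h2 ⊢
      split_ifs at h2 ⊢ <;> omega
    refine hmin (Fin.succ ⟨x, hx⟩) ?_ ?_
    · rw [← hcount]
      simp
    · rw [idealOf, Set.mem_ofPred_eq, h1]
      exact fun hp => hm' (hR p x (by simp at hlt; omega) hd hp)

/-! ## Hilbert functions -/

theorem hilb_idealOf_eq {n : ℕ} {N : Set (List ℕ)} {f : ℕ → ℤ} (hN : ∀ u ∈ N, Desc u)
    (hlt : ∀ u ∈ N, ∀ x ∈ u, x < n) (hf : f 0 = 1)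
    (h : ∀ t, ({u ∈ N | u.length = t}.ncard : ℤ) = nderiv f t) (t : ℕ) :
    (hilb (idealOf n N) t : ℤ) = f t := by
  induction t with
  | zero => rw [hilb_idealOf_zero hN hlt, h, hf, nderiv]
  | succ t ih => rw [hilb_idealOf_succ hN hlt, Nat.cast_add, ih, h, nderiv, add_sub_cancel]

theorem ncard_level_eq_nderiv {n : ℕ} {N : Set (List ℕ)} {f : ℕ → ℤ} (hN : ∀ u ∈ N, Desc u)
    (hlt : ∀ u ∈ N, ∀ x ∈ u, x < n) (hf : f 0 = 1)
    (h : ∀ t, (hilb (idealOf n N) t : ℤ) = f t) (t : ℕ) :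
    ({u ∈ N | u.length = t}.ncard : ℤ) = nderiv f t := by
  cases t with
  | zero => rw [← hilb_idealOf_zero hN hlt, h, hf, nderiv]
  | succ t => rw [nderiv, ← h, ← h, hilb_idealOf_succ hN hlt, Nat.cast_add, add_sub_cancel_left]

theorem IsStableOrderIdeal.lt_of_mem {n : ℕ} {N : Set (List ℕ)} (hN : IsStableOrderIdeal N)
    (h : ∀ x, [x] ∈ N → x < n) : ∀ u ∈ N, ∀ x ∈ u, x < n := by
  intro u hu x hx
  cases u with
  | nil => simp at hx
  | cons y l =>
    have hy := h y (hN.take hu 1)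
    rcases List.mem_cons.1 hx with rfl | hx
    · exact hy
    · exact ((desc_cons.1 (hN.desc _ hu)).1 x hx).trans_lt hy

theorem OSeq.toNat_succ_le {f : ℕ → ℤ} (hf : OSeq f) {t : ℕ} (ht : 1 ≤ t) :
    (f (t + 1)).toNat ≤ plusPlus (f t).toNat t :=
  Int.toNat_le.2 (hf.2.2 t ht)

theorem OSeq.toNat_zero {f : ℕ → ℤ} (hf : OSeq f) : (f 0).toNat = 1 := by
  simp [hf.2.1]

/-- The lexicographic order ideal with `D t` elements in every degree `t`. -/
def lexOrderIdeal (D : ℕ → ℕ) : Set (List ℕ) := {u | Desc u ∧ rank u < D u.length}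

theorem isStableOrderIdeal_lexOrderIdeal {D : ℕ → ℕ} (hD0 : 1 ≤ D 0)
    (hD : ∀ t, 1 ≤ t → D (t + 1) ≤ plusPlus (D t) t) :
    IsStableOrderIdeal (lexOrderIdeal D) where
  desc u hu := hu.1
  of_concat_mem p i := by
    rintro ⟨h1, h2⟩
    refine ⟨(desc_concat.1 h1).1, ?_⟩
    cases p with
    | nil => exact hD0
    | cons x l =>
      rw [List.length_append] at h2
      exact rank_lt_of_concat_lt_plusPlus h1 (by simp) (hD _ (by simp)) h2
  lower u hu v hv h := ⟨hv, (rank_mono h).trans_lt (by rw [h.length_eq]; exact hu.2)⟩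

theorem exists_stronglyStable_hilb_eq {f : ℕ → ℤ} (hf : OSeq f) (hf' : OSeq (nderiv f)) :
    ∃ (n : ℕ) (J : Set (Mon n)), StronglyStable J ∧ monSat J = J ∧
      ∀ t : ℕ, (hilb J t : ℤ) = f t := by
  have hN := isStableOrderIdeal_lexOrderIdeal (D := fun t => (nderiv f t).toNat)
    hf'.toNat_zero.ge fun t ht => hf'.toNat_succ_le ht
  refine ⟨(nderiv f 1).toNat, _, hN.stronglyStable_idealOf _, monSat_idealOf _ _,
    hilb_idealOf_eq hN.desc (hN.lt_of_mem fun x hx => ?_) hf.2.1 fun t => ?_⟩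
  · simpa [rank] using hx.2
  · rw [← Int.toNat_of_nonneg (hf'.1 t), ← ncard_rank_lt t (nderiv f t).toNat
      (by rintro rfl; exact hf'.toNat_zero.le)]
    congr 2
    ext u
    constructor
    · rintro ⟨⟨h1, h2⟩, rfl⟩
      exact ⟨h1, rfl, h2⟩
    · rintro ⟨h1, rfl, h2⟩
      exact ⟨⟨h1, h2⟩, rfl⟩

/-- Grafting: the minimal regularity does not exceed `R` if the derivative of the Hilbert function
agrees in degrees at least `R` with that of a Hilbert function of minimal regularity at most `R`,
and is not smaller in degree `R - 1`. -/
theorem mReg_le_of_nderiv_eq {q h : ℕ → ℤ} {s : ℕ} (hs : 1 ≤ s) (hq : OSeq q)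
    (hq' : OSeq (nderiv q)) (hh : OSeq h) (hh' : OSeq (nderiv h)) (hreg : mReg q ≤ s + 1)
    (heq : ∀ t, s + 1 ≤ t → nderiv h t = nderiv q t) (hle : nderiv q s ≤ nderiv h s) :
    mReg h ≤ s + 1 := by
  obtain ⟨n, J, hJ, hsat, hJq, hJr⟩ := Nat.sInf_mem
    (s := {r | ∃ (n : ℕ) (J : Set (Mon n)), StronglyStable J ∧ monSat J = J ∧
      (∀ t : ℕ, (hilb J t : ℤ) = q t) ∧ monReg J = r})
    (by
      obtain ⟨n, J, h1, h2, h3⟩ := exists_stronglyStable_hilb_eq hq hq'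
      exact ⟨_, n, J, h1, h2, h3, rfl⟩)
  replace hJr : monReg J ≤ s + 1 := hJr.le.trans hreg
  set N := orderIdeal J
  have hN : IsStableOrderIdeal N := hJ.isStableOrderIdeal
  have hNlt : ∀ u ∈ N, ∀ x ∈ u, x < n := fun u hu => hu.2.1
  have hfin : ∀ t, {u ∈ N | u.length = t}.Finite := fun t =>
    (finite_level hNlt t).subset fun u hu => ⟨hu.1, hu.2.le⟩
  have hNq := ncard_level_eq_nderiv hN.desc hNlt hq.2.1
    (by rwa [idealOf_orderIdeal hJ hsat])
  have hNR : ∀ p i, s + 1 ≤ p.length → Desc (p ++ [i]) → p ∈ N → p ++ [i] ∈ N :=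
    fun p i hp h1 h2 => hJ.concat_mem_orderIdeal (by omega) (by omega) h1 h2
  have hst := hN.isStable (hfin (s + 1))
  set D : ℕ → ℕ := fun t => (nderiv h t).toNat
  have hDh : ∀ t, (D t : ℤ) = nderiv h t := fun t => Int.toNat_of_nonneg (hh'.1 t)
  have hG : IsStableOrderIdeal
      (graft (s + 1) D (growthLex s {u ∈ N | u.length = s + 1})) := by
    refine isStableOrderIdeal_graft hh'.toNat_zero.ge (fun t ht _ => hh'.toNat_succ_le ht)
      (fun u hu v hv h => growthLex_lower hst hu hv h) fun p i hpi hp => ?_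
    obtain rfl : p.length = s := by omega
    refine (rank_lt_of_mem_growthLex hst hpi).trans_le ?_
    have h1 : (minQuot {u ∈ N | u.length = p.length + 1} 0).ncard ≤
        {u ∈ N | u.length = p.length}.ncard := by
      refine Set.ncard_le_ncard (fun u hu => ?_) (hfin _)
      rw [mem_quot_zero] at hu
      exact ⟨hN.of_concat_mem u 0 hu.1, by simpa using hu.2⟩
    have h2 := hNq p.length
    have h3 := hDh p.length
    omega
  have hilb_eq := hilb_idealOf_eq (n := D 1) (f := h) hG.desc
    (hG.lt_of_mem fun x hx => by simpa [rank] using hx.2.1 (by simp; omega)) hh.2.1 fun t => by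
      rcases Nat.lt_or_ge t (s + 1) with ht | ht
      · rw [ncard_graft_of_lt hh'.toNat_zero.le ht, hDh]
      · rw [ncard_graft_growthLex hs ht hN (hfin _) hNR, hNq, heq t ht]
  have hmem : mReg h ≤ monReg (idealOf (D 1) _) := Nat.sInf_le
    ⟨D 1, _, hG.stronglyStable_idealOf _, monSat_idealOf _ _, hilb_eq, rfl⟩
  exact hmem.trans (monReg_idealOf_le fun p i hp h1 h2 => concat_mem_graft hp h1 h2)

theorem OSeq.graft {f g : ℕ → ℤ} (hf : OSeq f) (hg : OSeq g) {m : ℕ} (hm : 1 < m)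
    (h : g (m - 1) ≤ f (m - 1)) : OSeq fun j => if j < m then f j else g j := by
  refine ⟨fun t => ?_, ?_, fun t ht => ?_⟩
  · dsimp only
    split_ifs
    exacts [hf.1 t, hg.1 t]
  · exact (if_pos (by omega)).trans hf.2.1
  · dsimp only
    split_ifs with h1 h2 h2
    · exact hf.2.2 t ht
    · omega
    · obtain rfl : t = m - 1 := by omega
      exact (hg.2.2 _ ht).trans
        (by exact_mod_cast plusPlus_mono (m - 1) (Int.toNat_le_toNat h))
    · exact hg.2.2 t ht

theorem nderiv_graft {f g : ℕ → ℤ} {m : ℕ} (hm : 0 < m) (h : f (m - 1) = g (m - 1)) :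
    nderiv (fun j => if j < m then f j else g j) =
      fun j => if j < m then nderiv f j else nderiv g j := by
  funext t
  cases t with
  | zero => simp [nderiv]
  | succ t =>
    simp only [nderiv]
    split_ifs with h1 h2 h2
    · rfl
    · omega
    · obtain rfl : t = m - 1 := by omega
      rw [h]
    · rfl

/-- Theorem `innesto`, ideal graft.
Let `q, w` be Hilbert functions of closed projective subschemes and `m > 1` an integer such
that `w(m-1) = q(m-1)` and `w(m-2) ≤ q(m-2)`. Then the function `h` with `h(j) = w(j)` for
`j < m` and `h(j) = q(j)` for `j ≥ m` is the Hilbert function of a closed projective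
subscheme and `m_h ≤ max{m, m_q}`. -/
theorem statement11 (q w : ℕ → ℤ)
    (hq : OSeq q ∧ OSeq (nderiv q)) (hw : OSeq w ∧ OSeq (nderiv w))
    (m : ℕ) (hm : 1 < m)
    (h1 : w (m - 1) = q (m - 1)) (h2 : w (m - 2) ≤ q (m - 2)) :
    (OSeq (fun j => if j < m then w j else q j) ∧
      OSeq (nderiv (fun j => if j < m then w j else q j))) ∧
    mReg (fun j => if j < m then w j else q j) ≤ max m (mReg q) := by
  have hd : nderiv q (m - 1) ≤ nderiv w (m - 1) := by
    obtain ⟨m, rfl⟩ : ∃ k, m = k + 2 := ⟨m - 2, by omega⟩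
    simp only [show m + 2 - 1 = m + 1 by omega, Nat.add_sub_cancel, nderiv] at *
    omega
  have hh := hw.1.graft hq.1 hm h1.ge
  have hder := nderiv_graft (f := w) (g := q) (by omega) h1
  have hh' : OSeq (nderiv fun j => if j < m then w j else q j) := by
    rw [hder]
    exact hw.2.graft hq.2 hm hd
  refine ⟨⟨hh, hh'⟩, ?_⟩
  obtain ⟨s, hs⟩ : ∃ s, max m (mReg q) = s + 1 := ⟨max m (mReg q) - 1, by omega⟩
  rw [hs]
  refine mReg_le_of_nderiv_eq (by omega) hq.1 hq.2 hh hh' (by omega) (fun t ht => ?_) ?_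
  · rw [hder]
    exact if_neg (by omega)
  · rw [hder]
    dsimp only
    split_ifs
    · obtain rfl : s = m - 1 := by omega
      exact hd
    · exact le_rfl
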